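/- Let n ≥ 1, s ∈ ℝ and 1 ≤ p, q < ∞. Suppose there exists a constant C > 0 such that ‖e^{iΔ}f‖_{W_{p,q}} ≤ C‖f‖_{W^s_{p,q}} for all f ∈ 𝒮(ℝⁿ), or such that ‖e^{−iΔ}f‖_{W_{p,q}} ≤ C‖f‖_{W^s_{p,q}} for all f ∈ 𝒮(ℝⁿ). Then there exists a constant C' > 0 such that (Σ_{k∈ℤⁿ} |c_k|^p)^{1/p} ≤ C' (Σ_{k∈ℤⁿ} ⟨k⟩^{sq} |c_k|^q)^{1/q} for every finitely supported sequence {c_k}_{k∈ℤⁿ} of complex numbers (i.e., c_k = 0 for all but finitely many k). -/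

import Mathlib

open MeasureTheory Real
open scoped ENNReal RealInnerProductSpace

noncomputable section

/-- The short-time Fourier transform
`V_g f (x, ξ) = ∫ e^{-i ξ·t} conj (g (t - x)) f t dt`. -/
def STFT {n : ℕ} (g f : EuclideanSpace ℝ (Fin n) → ℂ)
    (x ξ : EuclideanSpace ℝ (Fin n)) : ℂ :=
  ∫ t : EuclideanSpace ℝ (Fin n),
    Complex.exp (-(Complex.I * Complex.ofReal ⟪ξ, t⟫)) * (starRingEnd ℂ) (g (t - x)) * f t

/-- The Fourier transform `f̂ (ξ) = ∫ e^{-i ξ·x} f x dx`. -/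
def FT {n : ℕ} (f : EuclideanSpace ℝ (Fin n) → ℂ) (ξ : EuclideanSpace ℝ (Fin n)) : ℂ :=
  ∫ x : EuclideanSpace ℝ (Fin n),
    Complex.exp (-(Complex.I * Complex.ofReal ⟪ξ, x⟫)) * f x

/-- The power of the Japanese bracket `⟨x⟩ˢ = (1 + |x|²)^(s/2)`. -/
def jp {n : ℕ} (s : ℝ) (x : EuclideanSpace ℝ (Fin n)) : ℝ := (1 + ‖x‖ ^ 2) ^ (s / 2)

/-- The Gaussian window `g₀ (t) = e^{-|t|²}`. -/
def gauss {n : ℕ} (t : EuclideanSpace ℝ (Fin n)) : ℂ := Complex.ofReal (Real.exp (-‖t‖ ^ 2))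

/-- The `L^p` norm (valued in `ℝ≥0∞`) of an `ℝ≥0∞`-valued function. -/
def lpN {n : ℕ} (p : ℝ≥0∞) (F : EuclideanSpace ℝ (Fin n) → ℝ≥0∞) : ℝ≥0∞ :=
  if p = ∞ then essSup F volume
  else (∫⁻ x, F x ^ p.toReal) ^ p.toReal⁻¹

/-- The Wiener amalgam space norm `‖f‖_{W^s_{p,q}}`:
inner `L^q` norm in the frequency variable ξ, outer `L^p` norm in the space variable x,
with the Gaussian window. -/
def WNorm {n : ℕ} (s : ℝ) (p q : ℝ≥0∞) (f : EuclideanSpace ℝ (Fin n) → ℂ) : ℝ≥0∞ :=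
  lpN p (fun x => lpN q (fun ξ => ENNReal.ofReal (jp s ξ) * (‖STFT gauss f x ξ‖₊ : ℝ≥0∞)))

/-- The modulation space norm `‖f‖_{M^s_{p,q}}`:
inner `L^p` norm in the space variable x, outer `L^q` norm in the frequency variable ξ,
with the Gaussian window. -/
def MNorm {n : ℕ} (s : ℝ) (p q : ℝ≥0∞) (f : EuclideanSpace ℝ (Fin n) → ℂ) : ℝ≥0∞ :=
  lpN q (fun ξ => lpN p (fun x => ENNReal.ofReal (jp s ξ) * (‖STFT gauss f x ξ‖₊ : ℝ≥0∞)))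

/-- The Schrödinger operator `e^{iεΔ} f = ℱ⁻¹ [ξ ↦ e^{-iε|ξ|²} f̂ (ξ)]` (`ε = ±1`). -/
def schrod {n : ℕ} (ε : ℝ) (f : EuclideanSpace ℝ (Fin n) → ℂ)
    (x : EuclideanSpace ℝ (Fin n)) : ℂ :=
  (((2 * Real.pi) ^ n)⁻¹ : ℝ) *
    ∫ ξ : EuclideanSpace ℝ (Fin n),
      Complex.exp (Complex.I * Complex.ofReal ⟪x, ξ⟫) *
        Complex.exp (-(Complex.ofReal ε * Complex.I * Complex.ofReal (‖ξ‖ ^ 2))) * FT f ξ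

/-- The lattice point `k ∈ ℤⁿ` viewed as a point of `ℝⁿ`. -/
def zlift {n : ℕ} (k : Fin n → ℤ) : EuclideanSpace ℝ (Fin n) :=
  (WithLp.equiv 2 (Fin n → ℝ)).symm fun i => (k i : ℝ)

theorem iteratedDeriv_cexp_const_mul_ofReal (c : ℂ) (m : ℕ) :
    iteratedDeriv m (fun y : ℝ => Complex.exp (c * y)) =
      fun y : ℝ => c ^ m * Complex.exp (c * y) := by
  induction m with
  | zero => simp
  | succ m ih =>
    rw [iteratedDeriv_succ, ih]
    ext y
    have h : HasDerivAt (fun y : ℝ => Complex.exp (c * y)) (Complex.exp (c * y) * c) y := by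
      have h1 : HasDerivAt (fun y : ℝ => c * (y : ℂ)) c y := by
        simpa using (Complex.ofRealCLM.hasDerivAt (x := y)).const_mul c
      exact h1.cexp
    rw [(h.const_mul (c ^ m)).deriv]
    ring

theorem contDiff_cexp_const_mul_ofReal (c : ℂ) {N : WithTop ℕ∞} :
    ContDiff ℝ N (fun y : ℝ => Complex.exp (c * y)) :=
  (contDiff_const.mul Complex.ofRealCLM.contDiff).cexp

theorem hasTemperateGrowth_cexp_I_mul_inner {E : Type*} [NormedAddCommGroup E]
    [InnerProductSpace ℝ E] (k : E) :
    (fun x : E => Complex.exp (Complex.I * (⟪k, x⟫ : ℝ))).HasTemperateGrowth := by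
  have h : (fun y : ℝ => Complex.exp (Complex.I * y)).HasTemperateGrowth := by
    refine ⟨contDiff_cexp_const_mul_ofReal _, fun m => ⟨0, 1, fun y => ?_⟩⟩
    rw [norm_iteratedFDeriv_eq_norm_iteratedDeriv, iteratedDeriv_cexp_const_mul_ofReal]
    simp [Complex.norm_exp]
  exact h.comp (Function.hasTemperateGrowth_inner_right k)

theorem one_add_pow_mul_exp_neg_sq_le (M : ℕ) {r : ℝ} (hr : 0 ≤ r) :
    (1 + r) ^ M * Real.exp (-r ^ 2) ≤ M.factorial * Real.exp 2 := by
  have h1 : (1 + r) ^ M ≤ M.factorial * Real.exp (1 + r) := by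
    have := Real.pow_div_factorial_le_exp (1 + r) (by positivity) M
    rwa [div_le_iff₀ (by positivity), mul_comm] at this
  calc (1 + r) ^ M * Real.exp (-r ^ 2) ≤ M.factorial * Real.exp (1 + r) * Real.exp (-r ^ 2) := by
        gcongr
    _ = M.factorial * Real.exp ((1 + r) + (-r ^ 2)) := by
        rw [mul_assoc, ← Real.exp_add]
    _ ≤ _ := by
        gcongr
        nlinarith [sq_nonneg (r - 1 / 2)]

/-- The complex-valued Gaussian `e^{-|x|²}` as a Schwartz function. -/
noncomputable def gaussianSchwartz (E : Type*) [NormedAddCommGroup E] [InnerProductSpace ℝ E] :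
    SchwartzMap E ℂ where
  toFun x := Complex.exp (-1 * ((‖x‖ ^ 2 : ℝ) : ℂ))
  smooth' := (contDiff_cexp_const_mul_ofReal (-1)).comp (contDiff_norm_sq ℝ)
  decay' := by
    intro m N
    obtain ⟨k, C, hC, h⟩ :=
      (Function.hasTemperateGrowth_norm_sq E).norm_iteratedFDeriv_le_uniform N
    refine ⟨N.factorial * (C + 1) ^ N * ((m + k * N).factorial * Real.exp 2), fun x => ?_⟩
    have hx : 1 ≤ 1 + ‖x‖ := by simp
    have key := norm_iteratedFDeriv_comp_le (𝕜 := ℝ) (n := N) (N := N)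
      (g := fun y : ℝ => Complex.exp (-1 * y)) (f := fun x : E => ‖x‖ ^ 2)
      (contDiff_cexp_const_mul_ofReal _) (contDiff_norm_sq ℝ) le_rfl x
      (C := Real.exp (-‖x‖ ^ 2)) (D := (C + 1) * (1 + ‖x‖) ^ k)
      (fun i _ => by
        rw [norm_iteratedFDeriv_eq_norm_iteratedDeriv, iteratedDeriv_cexp_const_mul_ofReal]
        simp [Complex.norm_exp, -Complex.ofReal_pow])
      (fun i hi hiN => by
        have h1 : 1 ≤ (C + 1) * (1 + ‖x‖) ^ k :=
          one_le_mul_of_one_le_of_one_le (by linarith) (one_le_pow₀ hx)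
        calc _ ≤ C * (1 + ‖x‖) ^ k := h i hiN x
          _ ≤ (C + 1) * (1 + ‖x‖) ^ k := by gcongr; linarith
          _ ≤ _ := le_self_pow₀ h1 (by lia))
    calc _ ≤ (1 + ‖x‖) ^ m *
          (N.factorial * Real.exp (-‖x‖ ^ 2) * ((C + 1) * (1 + ‖x‖) ^ k) ^ N) := by
          refine mul_le_mul ?_ key (norm_nonneg _) (by positivity)
          gcongr; linarith
      _ = N.factorial * (C + 1) ^ N * ((1 + ‖x‖) ^ (m + k * N) * Real.exp (-‖x‖ ^ 2)) := by
          rw [mul_pow, pow_add, pow_mul]; ring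
      _ ≤ _ := by
          exact mul_le_mul_of_nonneg_left (one_add_pow_mul_exp_neg_sq_le _ (norm_nonneg x))
            (by positivity)

/-- The modulated Gaussian `e^{i k·x} e^{-|x|²}` as a Schwartz function. -/
noncomputable def modulatedGaussian {E : Type*} [NormedAddCommGroup E] [InnerProductSpace ℝ E]
    (k : E) : SchwartzMap E ℂ :=
  SchwartzMap.smulLeftCLM ℂ (fun x : E => Complex.exp (Complex.I * (⟪k, x⟫ : ℝ)))
    (gaussianSchwartz E)

theorem modulatedGaussian_apply {E : Type*} [NormedAddCommGroup E] [InnerProductSpace ℝ E]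
    (k x : E) : modulatedGaussian k x =
      Complex.exp (-(‖x‖ ^ 2 : ℝ) + Complex.I * (⟪k, x⟫ : ℝ)) := by
  rw [modulatedGaussian, SchwartzMap.smulLeftCLM_apply_apply
    (hasTemperateGrowth_cexp_I_mul_inner k), add_comm, Complex.exp_add, smul_eq_mul]
  congr 1
  change Complex.exp (-1 * ((‖x‖ ^ 2 : ℝ) : ℂ)) = _
  simp

section GaussianIntegrals

variable {n : ℕ}

theorem EuclideanSpace.ofReal_inner_eq_sum (x y : EuclideanSpace ℝ (Fin n)) :
    ((⟪x, y⟫ : ℝ) : ℂ) = ∑ i, (x i : ℂ) * y i := by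
  simp [PiLp.inner_apply, mul_comm]

theorem EuclideanSpace.ofReal_norm_sq_eq_sum (x : EuclideanSpace ℝ (Fin n)) :
    ((‖x‖ : ℝ) : ℂ) ^ 2 = ∑ i, (x i : ℂ) ^ 2 := by
  rw [← Complex.ofReal_pow, EuclideanSpace.real_norm_sq_eq]
  push_cast
  rfl

theorem integrable_cexp_quadratic_euclideanSpace {b : ℂ} (hb : 0 < b.re) (c : Fin n → ℂ) (d : ℂ) :
    Integrable (fun t : EuclideanSpace ℝ (Fin n) =>
      Complex.exp (-b * (‖t‖ : ℂ) ^ 2 + ∑ i, c i * t i + d)) := by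
  simp_rw [Complex.exp_add _ d]
  refine Integrable.mul_const ?_ _
  rw [← (PiLp.volume_preserving_toLp (Fin n)).integrable_comp_emb
    (MeasurableEquiv.toLp 2 _).measurableEmbedding]
  simpa [Function.comp_def, EuclideanSpace.ofReal_norm_sq_eq_sum]
    using GaussianFourier.integrable_cexp_neg_mul_sum_add hb c

theorem integral_cexp_quadratic_euclideanSpace {b : ℂ} (hb : 0 < b.re) (c : Fin n → ℂ) (d : ℂ) :
    ∫ t : EuclideanSpace ℝ (Fin n), Complex.exp (-b * (‖t‖ : ℂ) ^ 2 + ∑ i, c i * t i + d) =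
      (π / b) ^ (n / 2 : ℂ) * Complex.exp ((∑ i, c i ^ 2) / (4 * b) + d) := by
  simp_rw [Complex.exp_add _ d]
  rw [integral_mul_const, ← mul_assoc]
  congr 1
  rw [← (PiLp.volume_preserving_toLp (Fin n)).integral_comp
    (MeasurableEquiv.toLp 2 _).measurableEmbedding]
  simpa [EuclideanSpace.ofReal_norm_sq_eq_sum]
    using GaussianFourier.integral_cexp_neg_mul_sum_add hb c

theorem FT_integrand_modulatedGaussian (k ξ t : EuclideanSpace ℝ (Fin n)) :
    Complex.exp (-(Complex.I * Complex.ofReal ⟪ξ, t⟫)) * modulatedGaussian k t =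
      Complex.exp (-1 * (‖t‖ : ℂ) ^ 2 + ∑ i, Complex.I * (k i - ξ i) * t i + 0) := by
  rw [modulatedGaussian_apply, ← Complex.exp_add]
  congr 1
  push_cast
  simp only [EuclideanSpace.ofReal_inner_eq_sum, EuclideanSpace.ofReal_norm_sq_eq_sum,
    Finset.mul_sum, ← Finset.sum_neg_distrib, ← Finset.sum_add_distrib, add_zero]
  exact Finset.sum_congr rfl fun i _ => by ring

theorem FT_modulatedGaussian (k ξ : EuclideanSpace ℝ (Fin n)) :
    FT (modulatedGaussian k) ξ =
      (π : ℂ) ^ (n / 2 : ℂ) * Complex.exp (-(∑ i, ((k i : ℂ) - ξ i) ^ 2) / 4) := by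
  simp_rw [FT, FT_integrand_modulatedGaussian]
  rw [integral_cexp_quadratic_euclideanSpace (by simp)]
  simp [mul_pow]

/-- The image `e^{iεΔ}` of the modulated Gaussian `e^{i k·x} e^{-|x|²}`. -/
def evolvedGaussian (ε : ℝ) (k x : EuclideanSpace ℝ (Fin n)) : ℂ :=
  (((2 * Real.pi) ^ n)⁻¹ : ℝ) * ((π : ℂ) ^ (n / 2 : ℂ) *
    ((π / (1 / 4 + ε * Complex.I)) ^ (n / 2 : ℂ) *
      Complex.exp ((∑ i, (Complex.I * x i + k i / 2) ^ 2) / (4 * (1 / 4 + ε * Complex.I))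
        + -(∑ i, (k i : ℂ) ^ 2) / 4)))

theorem schrod_integrand_modulatedGaussian (ε : ℝ) (k x ξ : EuclideanSpace ℝ (Fin n)) :
    Complex.exp (Complex.I * Complex.ofReal ⟪x, ξ⟫) *
        Complex.exp (-(Complex.ofReal ε * Complex.I * Complex.ofReal (‖ξ‖ ^ 2))) *
        FT (modulatedGaussian k) ξ =
      (π : ℂ) ^ (n / 2 : ℂ) * Complex.exp (-(1 / 4 + ε * Complex.I) * (‖ξ‖ : ℂ) ^ 2 +
        ∑ i, (Complex.I * x i + k i / 2) * ξ i + -(∑ i, (k i : ℂ) ^ 2) / 4) := by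
  rw [FT_modulatedGaussian, mul_left_comm, ← Complex.exp_add, ← Complex.exp_add]
  congr 2
  push_cast
  simp only [EuclideanSpace.ofReal_inner_eq_sum, EuclideanSpace.ofReal_norm_sq_eq_sum,
    Finset.mul_sum, ← Finset.sum_neg_distrib, ← Finset.sum_add_distrib, Finset.sum_div]
  exact Finset.sum_congr rfl fun i _ => by ring

theorem FT_sum_modulatedGaussian {ι : Type*} (T : Finset ι) (d : ι → ℂ)
    (k : ι → EuclideanSpace ℝ (Fin n)) (ξ : EuclideanSpace ℝ (Fin n)) :
    FT (∑ j ∈ T, d j • modulatedGaussian (k j) : SchwartzMap _ ℂ) ξ =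
      ∑ j ∈ T, d j * FT (modulatedGaussian (k j)) ξ := by
  simp_rw [FT, ← integral_const_mul]
  rw [← integral_finsetSum]
  · simp [Finset.mul_sum, mul_left_comm]
  · intro j _
    refine Integrable.const_mul ?_ _
    simp_rw [FT_integrand_modulatedGaussian]
    exact integrable_cexp_quadratic_euclideanSpace (by simp) _ _

theorem schrod_sum_modulatedGaussian {ι : Type*} (ε : ℝ) (T : Finset ι) (d : ι → ℂ)
    (k : ι → EuclideanSpace ℝ (Fin n)) :
    schrod ε (∑ j ∈ T, d j • modulatedGaussian (k j) : SchwartzMap _ ℂ) =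
      fun x => ∑ j ∈ T, d j * evolvedGaussian ε (k j) x := by
  have hb : 0 < ((1 / 4 : ℂ) + ε * Complex.I).re := by simp
  ext x
  have hterm : ∀ j, d j * evolvedGaussian ε (k j) x = (((2 * Real.pi) ^ n)⁻¹ : ℝ) *
      ∫ ξ : EuclideanSpace ℝ (Fin n), d j *
      (Complex.exp (Complex.I * Complex.ofReal ⟪x, ξ⟫) *
        Complex.exp (-(Complex.ofReal ε * Complex.I * Complex.ofReal (‖ξ‖ ^ 2))) *
        FT (modulatedGaussian (k j)) ξ) := by
    intro j
    simp_rw [schrod_integrand_modulatedGaussian, integral_const_mul]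
    rw [integral_cexp_quadratic_euclideanSpace hb, evolvedGaussian]
    ring
  simp_rw [hterm, ← Finset.mul_sum, schrod]
  rw [← integral_finsetSum]
  · simp_rw [FT_sum_modulatedGaussian, Finset.mul_sum, mul_left_comm]
  · intro j _
    refine Integrable.const_mul ?_ _
    simp_rw [schrod_integrand_modulatedGaussian]
    exact (integrable_cexp_quadratic_euclideanSpace hb _ _).const_mul _

theorem conj_gauss (t : EuclideanSpace ℝ (Fin n)) :
    (starRingEnd ℂ) (gauss t) = Complex.exp (-(‖t‖ : ℂ) ^ 2) := by
  rw [gauss, Complex.conj_ofReal]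
  simp

theorem STFT_integrand_modulatedGaussian (k x ξ t : EuclideanSpace ℝ (Fin n)) :
    Complex.exp (-(Complex.I * Complex.ofReal ⟪ξ, t⟫)) * (starRingEnd ℂ) (gauss (t - x)) *
        modulatedGaussian k t =
      Complex.exp (-2 * (‖t‖ : ℂ) ^ 2 + ∑ i, (2 * x i - Complex.I * (ξ i - k i)) * t i
        + -(∑ i, (x i : ℂ) ^ 2)) := by
  rw [modulatedGaussian_apply, conj_gauss, ← Complex.exp_add, ← Complex.exp_add]
  congr 1
  push_cast
  simp only [EuclideanSpace.ofReal_inner_eq_sum, EuclideanSpace.ofReal_norm_sq_eq_sum,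
    Finset.mul_sum, ← Finset.sum_neg_distrib, ← Finset.sum_add_distrib, PiLp.sub_apply]
  exact Finset.sum_congr rfl fun i _ => by push_cast; ring

theorem STFT_sum_modulatedGaussian {ι : Type*} (T : Finset ι) (d : ι → ℂ)
    (k : ι → EuclideanSpace ℝ (Fin n)) (x ξ : EuclideanSpace ℝ (Fin n)) :
    STFT gauss (∑ j ∈ T, d j • modulatedGaussian (k j) : SchwartzMap _ ℂ) x ξ =
      ∑ j ∈ T, d j * STFT gauss (modulatedGaussian (k j)) x ξ := by
  simp_rw [STFT, ← integral_const_mul]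
  rw [← integral_finsetSum]
  · simp [Finset.mul_sum, mul_left_comm]
  · intro j _
    refine Integrable.const_mul ?_ _
    simp_rw [STFT_integrand_modulatedGaussian]
    exact integrable_cexp_quadratic_euclideanSpace (by simp) _ _

theorem norm_STFT_modulatedGaussian (k x ξ : EuclideanSpace ℝ (Fin n)) :
    ‖STFT gauss (modulatedGaussian k) x ξ‖ = ‖((π : ℂ) / 2) ^ (n / 2 : ℂ)‖ *
      (Real.exp (-‖x‖ ^ 2 / 2) * Real.exp (-‖ξ - k‖ ^ 2 / 8)) := by
  simp_rw [STFT, STFT_integrand_modulatedGaussian]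
  rw [integral_cexp_quadratic_euclideanSpace (by simp), norm_mul, ← Real.exp_add,
    Complex.norm_exp]
  congr 2
  have : (∑ i, (2 * (x i : ℂ) - Complex.I * (ξ i - k i)) ^ 2) / (4 * 2) + -(∑ i, (x i : ℂ) ^ 2) =
      ((-‖x‖ ^ 2 / 2 + -‖ξ - k‖ ^ 2 / 8 : ℝ) : ℂ)
        + ((-∑ i, x i * (ξ i - k i) / 2 : ℝ) : ℂ) * Complex.I := by
    push_cast
    simp only [EuclideanSpace.ofReal_norm_sq_eq_sum,
      ← Finset.sum_neg_distrib, ← Finset.sum_add_distrib, Finset.sum_div, Finset.sum_mul,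
      PiLp.sub_apply]
    refine Finset.sum_congr rfl fun i _ => ?_
    push_cast
    linear_combination ((ξ i : ℂ) - k i) ^ 2 / 8 * Complex.I_sq
  rw [this, Complex.add_re, Complex.re_ofReal_mul, Complex.I_re, mul_zero, add_zero,
    Complex.ofReal_re]

theorem STFT_integrand_evolvedGaussian (ε : ℝ) (k x ξ t : EuclideanSpace ℝ (Fin n)) {β : ℂ}
    (hβ : β = 1 / (4 * (1 / 4 + ε * Complex.I))) :
    Complex.exp (-(Complex.I * Complex.ofReal ⟪ξ, t⟫)) * (starRingEnd ℂ) (gauss (t - x)) *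
        evolvedGaussian ε k t =
      ((((2 * Real.pi) ^ n)⁻¹ : ℝ) * (π : ℂ) ^ (n / 2 : ℂ) *
        (π / (1 / 4 + ε * Complex.I)) ^ (n / 2 : ℂ)) *
      Complex.exp (-(1 + β) * (‖t‖ : ℂ) ^ 2 +
        ∑ i, (2 * x i - Complex.I * ξ i + Complex.I * β * k i) * t i
        + ∑ i, (-(x i : ℂ) ^ 2 + (β - 1) / 4 * (k i) ^ 2)) := by
  rw [conj_gauss, evolvedGaussian, div_eq_mul_one_div _ (4 * (1 / 4 + (ε : ℂ) * Complex.I)), ← hβ,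
    ← Complex.exp_add]
  simp_rw [← mul_assoc]
  rw [mul_comm (Complex.exp _)]
  simp_rw [mul_assoc]
  rw [mul_left_comm (Complex.exp _), mul_left_comm (Complex.exp _), ← Complex.exp_add]
  congr 4
  simp only [EuclideanSpace.ofReal_inner_eq_sum, EuclideanSpace.ofReal_norm_sq_eq_sum,
    Finset.mul_sum, ← Finset.sum_neg_distrib, ← Finset.sum_add_distrib, PiLp.sub_apply,
    Finset.sum_div, Finset.sum_mul]
  refine Finset.sum_congr rfl fun i _ => ?_
  push_cast
  linear_combination β * (t i : ℂ) ^ 2 * Complex.I_sq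

theorem one_add_re_pos {ε : ℝ} {β : ℂ} (hβ : β = 1 / (4 * (1 / 4 + ε * Complex.I))) :
    1 ≤ (1 + β).re := by
  have : β = (1 + 4 * ε * Complex.I)⁻¹ := by rw [hβ, one_div]; congr 1; ring
  rw [this, Complex.add_re, Complex.one_re, Complex.inv_re]
  have h : (0 : ℝ) ≤ (1 + 4 * (ε : ℂ) * Complex.I).re := by simp
  have := div_nonneg h (Complex.normSq_nonneg (1 + 4 * (ε : ℂ) * Complex.I))
  linarith

theorem STFT_evolvedGaussian (ε : ℝ) (k x ξ : EuclideanSpace ℝ (Fin n)) {β : ℂ}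
    (hβ : β = 1 / (4 * (1 / 4 + ε * Complex.I))) :
    STFT gauss (evolvedGaussian ε k) x ξ =
      ((((2 * Real.pi) ^ n)⁻¹ : ℝ) * (π : ℂ) ^ (n / 2 : ℂ) *
        (π / (1 / 4 + ε * Complex.I)) ^ (n / 2 : ℂ)) * ((π / (1 + β)) ^ (n / 2 : ℂ) *
      Complex.exp ((∑ i, (2 * x i - Complex.I * ξ i + Complex.I * β * k i) ^ 2) / (4 * (1 + β))
        + ∑ i, (-(x i : ℂ) ^ 2 + (β - 1) / 4 * (k i) ^ 2))) := by
  simp_rw [STFT, STFT_integrand_evolvedGaussian ε k _ _ _ hβ]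
  rw [integral_const_mul, integral_cexp_quadratic_euclideanSpace
    (zero_lt_one.trans_le (one_add_re_pos hβ))]

theorem STFT_sum_evolvedGaussian {ι : Type*} (ε : ℝ) (T : Finset ι) (d : ι → ℂ)
    (k : ι → EuclideanSpace ℝ (Fin n)) (x ξ : EuclideanSpace ℝ (Fin n)) :
    STFT gauss (fun x => ∑ j ∈ T, d j * evolvedGaussian ε (k j) x) x ξ =
      ∑ j ∈ T, d j * STFT gauss (evolvedGaussian ε (k j)) x ξ := by
  simp_rw [STFT, ← integral_const_mul]
  rw [← integral_finsetSum]
  · simp [Finset.mul_sum, mul_left_comm]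
  · intro j _
    refine Integrable.const_mul ?_ _
    simp_rw [STFT_integrand_evolvedGaussian ε _ _ _ _ rfl]
    exact (integrable_cexp_quadratic_euclideanSpace
      (zero_lt_one.trans_le (one_add_re_pos rfl)) _ _).const_mul _

theorem continuous_STFT_evolvedGaussian (ε : ℝ) (k : EuclideanSpace ℝ (Fin n)) :
    Continuous fun z : EuclideanSpace ℝ (Fin n) × EuclideanSpace ℝ (Fin n) =>
      STFT gauss (evolvedGaussian ε k) z.1 z.2 := by
  simp_rw [STFT_evolvedGaussian ε k _ _ rfl]
  fun_prop

theorem exists_le_norm_STFT_evolvedGaussian {ε : ℝ} (hε : ε ^ 2 = 1) :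
    ∃ δ : ℝ, 0 < δ ∧ ∀ k x ξ : EuclideanSpace ℝ (Fin n),
      ‖x - (2 * ε) • k‖ ≤ 1 → ‖ξ - k‖ ≤ 1 → δ ≤ ‖STFT gauss (evolvedGaussian ε k) x ξ‖ := by
  obtain ⟨β, hβ⟩ : ∃ β : ℂ, β = 1 / (4 * (1 / 4 + ε * Complex.I)) := ⟨_, rfl⟩
  have hεC : (ε : ℂ) ^ 2 = 1 := by exact_mod_cast hε
  have hb : ((1 / 4 : ℂ) + ε * Complex.I) ≠ 0 := by
    intro h
    simpa using congrArg Complex.re h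
  have hb' : (4 : ℂ)⁻¹ + ε * Complex.I ≠ 0 := by rwa [← one_div]
  have hβ1 : β * (1 + 4 * ε * Complex.I) = 1 := by
    rw [hβ, one_div, inv_mul_eq_one₀ (mul_ne_zero (by norm_num) hb)]
    ring
  have hβ17 : 17 * β = 1 - 4 * ε * Complex.I := by
    linear_combination (1 - 4 * ε * Complex.I) * hβ1 + 16 * β * ε ^ 2 * Complex.I_sq
      - 16 * β * hεC
  have hBre := one_add_re_pos hβ
  have hB : 1 + β ≠ 0 := by
    intro h
    rw [h] at hBre
    norm_num at hBre
  have hBn : 1 ≤ ‖1 + β‖ := hBre.trans (Complex.re_le_norm _)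
  have hπ : (π : ℂ) ≠ 0 := by exact_mod_cast Real.pi_ne_zero
  obtain ⟨K, hK⟩ : ∃ K : ℂ, K = ((((2 * Real.pi) ^ n)⁻¹ : ℝ) * (π : ℂ) ^ (n / 2 : ℂ) *
        (π / (1 / 4 + ε * Complex.I)) ^ (n / 2 : ℂ)) * (π / (1 + β)) ^ (n / 2 : ℂ) := ⟨_, rfl⟩
  have hK0 : K ≠ 0 := by
    rw [hK]
    have h1 : (((2 * Real.pi) ^ n)⁻¹ : ℝ) ≠ 0 := by positivity
    have h2 : ((((2 * Real.pi) ^ n)⁻¹ : ℝ) : ℂ) ≠ 0 := by exact_mod_cast h1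
    refine mul_ne_zero (mul_ne_zero (mul_ne_zero h2 ?_) ?_) ?_ <;>
      simp [Complex.cpow_eq_zero_iff, hπ, hb', hB]
  refine ⟨‖K‖ * Real.exp (-4), mul_pos (norm_pos_iff.2 hK0) (Real.exp_pos _), ?_⟩
  intro k x ξ hx hξ
  rw [STFT_evolvedGaussian ε k x ξ hβ, ← mul_assoc, ← hK, norm_mul, Complex.norm_exp]
  gcongr
  set y := x - (2 * ε) • k with hy
  set η := ξ - k with hη
  have hZ : (∑ i, (2 * (x i : ℂ) - Complex.I * ξ i + Complex.I * β * k i) ^ 2) / (4 * (1 + β))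
        + ∑ i, (-(x i : ℂ) ^ 2 + (β - 1) / 4 * (k i) ^ 2) =
      (∑ i, (2 * (y i : ℂ) - Complex.I * η i) ^ 2) / (4 * (1 + β)) + ((-‖y‖ ^ 2 : ℝ) : ℂ)
        + ((∑ i, (-(2 * ε * k i * η i) - ε * k i ^ 2) : ℝ) : ℂ) * Complex.I := by
    push_cast
    simp only [EuclideanSpace.ofReal_norm_sq_eq_sum,
      ← Finset.sum_neg_distrib, ← Finset.sum_add_distrib, Finset.sum_div, Finset.sum_mul]
    refine Finset.sum_congr rfl fun i _ => ?_
    have hx' : (x i : ℂ) = y i + 2 * ε * k i := by simp [hy]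
    have hξ' : (ξ i : ℂ) = η i + k i := by simp [hη]
    have hc : 2 * (x i : ℂ) - Complex.I * ξ i + Complex.I * β * k i =
        (2 * (y i : ℂ) - Complex.I * η i) + 4 * ε * (1 + β) * k i := by
      rw [hx', hξ']
      linear_combination Complex.I * k i * hβ1 - 4 * ε * β * k i * Complex.I_sq
    have hsq : ((2 * (y i : ℂ) - Complex.I * η i) + 4 * ε * (1 + β) * k i) ^ 2 / (4 * (1 + β)) =
        (2 * (y i : ℂ) - Complex.I * η i) ^ 2 / (4 * (1 + β)) +
          2 * ε * k i * (2 * (y i : ℂ) - Complex.I * η i) + 4 * ε ^ 2 * (1 + β) * k i ^ 2 := by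
      field_simp
      ring
    rw [hc, hsq, hx']
    linear_combination (k i : ℂ) ^ 2 / 4 * hβ17 + 4 * β * (k i : ℂ) ^ 2 * hεC
  have hnorm : ‖(∑ i, (2 * (y i : ℂ) - Complex.I * η i) ^ 2) / (4 * (1 + β))‖ ≤ 3 := by
    rw [norm_div]
    have h4 : 4 ≤ ‖4 * (1 + β)‖ := by rw [norm_mul]; norm_num; linarith
    rw [div_le_iff₀ (by linarith)]
    have h1 : ‖∑ i, (2 * (y i : ℂ) - Complex.I * η i) ^ 2‖ ≤ ∑ i, (8 * y i ^ 2 + 2 * η i ^ 2) := by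
      refine norm_sum_le_of_le _ fun i _ => ?_
      rw [norm_pow]
      have h2 : ‖2 * (y i : ℂ) - Complex.I * η i‖ ≤ 2 * |y i| + |η i| := by
        refine (norm_sub_le _ _).trans ?_
        simp
      calc _ ≤ (2 * |y i| + |η i|) ^ 2 := by gcongr
        _ ≤ _ := by nlinarith [sq_nonneg (2 * |y i| - |η i|), sq_abs (y i), sq_abs (η i)]
    rw [Finset.sum_add_distrib, ← Finset.mul_sum, ← Finset.mul_sum,
      ← EuclideanSpace.real_norm_sq_eq, ← EuclideanSpace.real_norm_sq_eq] at h1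
    have h5 : ‖y‖ ^ 2 ≤ 1 := pow_le_one₀ (norm_nonneg _) hx
    have h6 : ‖η‖ ^ 2 ≤ 1 := pow_le_one₀ (norm_nonneg _) hξ
    linarith
  rw [hZ, Complex.add_re, Complex.add_re, Complex.re_ofReal_mul, Complex.I_re, mul_zero, add_zero,
    Complex.ofReal_re]
  have h5 : ‖y‖ ^ 2 ≤ 1 := pow_le_one₀ (norm_nonneg _) hx
  have := (abs_le.1 ((Complex.abs_re_le_norm _).trans hnorm)).1
  linarith

end GaussianIntegrals

section UpperBound

variable {n : ℕ}

theorem one_le_norm_zlift_sub {k l : Fin n → ℤ} (h : k ≠ l) : 1 ≤ ‖zlift k - zlift l‖ := by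
  obtain ⟨i, hi⟩ := Function.ne_iff.1 h
  refine le_trans ?_ (PiLp.norm_apply_le (zlift k - zlift l) i)
  have h1 : (zlift k - zlift l) i = ((k i - l i : ℤ) : ℝ) := by simp [zlift]
  rw [h1, Real.norm_eq_abs]
  exact_mod_cast Int.one_le_abs (sub_ne_zero.2 hi)

theorem jp_pos (s : ℝ) (x : EuclideanSpace ℝ (Fin n)) : 0 < jp s x := by
  unfold jp
  positivity

theorem jp_rpow (s q : ℝ) (x : EuclideanSpace ℝ (Fin n)) : jp s x ^ q = jp (s * q) x := by
  unfold jp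
  rw [← Real.rpow_mul (by positivity)]
  congr 1
  ring

theorem one_add_norm_sq_le (x y : EuclideanSpace ℝ (Fin n)) :
    1 + ‖x‖ ^ 2 ≤ 2 * ((1 + ‖y‖ ^ 2) * (1 + ‖x - y‖ ^ 2)) := by
  have h : ‖x‖ ≤ ‖y‖ + ‖x - y‖ := by
    simpa using norm_add_le y (x - y)
  have h2 : ‖x‖ ^ 2 ≤ (‖y‖ + ‖x - y‖) ^ 2 := by gcongr
  nlinarith [sq_nonneg (‖y‖ - ‖x - y‖), mul_nonneg (sq_nonneg ‖y‖) (sq_nonneg ‖x - y‖)]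

/-- Peetre's inequality. -/
theorem jp_le_mul_jp (t : ℝ) (x y : EuclideanSpace ℝ (Fin n)) :
    jp t x ≤ 2 ^ (|t| / 2) * jp t y * jp |t| (x - y) := by
  unfold jp
  rcases le_total 0 t with ht | ht
  · rw [abs_of_nonneg ht, mul_assoc, ← Real.mul_rpow (by positivity) (by positivity),
      ← Real.mul_rpow (by positivity) (by positivity)]
    exact Real.rpow_le_rpow (by positivity) (one_add_norm_sq_le x y) (by positivity)
  · have h := Real.rpow_le_rpow (by positivity) (one_add_norm_sq_le y x)
      (by linarith : 0 ≤ -t / 2)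
    rw [norm_sub_rev, Real.mul_rpow (by positivity) (by positivity),
      Real.mul_rpow (by positivity) (by positivity), neg_div, Real.rpow_neg (by positivity) (t / 2),
      Real.rpow_neg (x := 1 + ‖x‖ ^ 2) (by positivity) (t / 2)] at h
    rw [abs_of_nonpos ht, neg_div]
    have h1 : 0 < (1 + ‖x‖ ^ 2) ^ (t / 2) := by positivity
    have h2 : 0 < (1 + ‖y‖ ^ 2) ^ (t / 2) := by positivity
    have h3 := mul_le_mul_of_nonneg_right h (mul_pos h1 h2).le
    field_simp at h3
    linarith

theorem integrable_exp_neg_norm_sq_div {a : ℝ} (ha : 0 < a) :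
    Integrable fun x : EuclideanSpace ℝ (Fin n) => Real.exp (-‖x‖ ^ 2 / a) := by
  have h := (integrable_cexp_quadratic_euclideanSpace (n := n) (b := ((1 / a : ℝ) : ℂ))
    (by simpa using ha) 0 0).norm
  refine h.congr (Filter.Eventually.of_forall fun x => ?_)
  have : (-((1 / a : ℝ) : ℂ) * (‖x‖ : ℂ) ^ 2 + ∑ i, (0 : Fin n → ℂ) i * x i + 0) =
      ((-‖x‖ ^ 2 / a : ℝ) : ℂ) := by
    push_cast
    simp
    ring
  simp only [this, Complex.norm_exp, Complex.ofReal_re]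

theorem integrable_jp_mul_exp (t : ℝ) :
    Integrable fun x : EuclideanSpace ℝ (Fin n) => jp t x * Real.exp (-‖x‖ ^ 2 / 8) := by
  obtain ⟨N, hN⟩ := exists_nat_ge (t / 2)
  refine ((integrable_exp_neg_norm_sq_div (n := n) (a := 16) (by norm_num)).const_mul
    (16 ^ N * (N.factorial * Real.exp (1 / 16)))).mono' ?_ ?_
  · have : Continuous fun x : EuclideanSpace ℝ (Fin n) => jp t x * Real.exp (-‖x‖ ^ 2 / 8) := by
      unfold jp
      refine Continuous.mul (Continuous.rpow_const (by fun_prop) fun x => Or.inl ?_) (by fun_prop)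
      positivity
    exact this.aestronglyMeasurable
  · refine Filter.Eventually.of_forall fun x => ?_
    have h1 : jp t x ≤ (1 + ‖x‖ ^ 2) ^ N := by
      rw [← Real.rpow_natCast]
      exact Real.rpow_le_rpow_of_exponent_le (by simp) hN
    have h2 : (1 + ‖x‖ ^ 2) ^ N ≤ 16 ^ N * (N.factorial * Real.exp ((1 + ‖x‖ ^ 2) / 16)) := by
      have := Real.pow_div_factorial_le_exp ((1 + ‖x‖ ^ 2) / 16) (by positivity) N
      rw [div_le_iff₀ (by positivity), div_pow, div_le_iff₀ (by positivity)] at this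
      linarith
    rw [Real.norm_of_nonneg (mul_pos (jp_pos _ _) (Real.exp_pos _)).le]
    calc _ ≤ 16 ^ N * (N.factorial * Real.exp ((1 + ‖x‖ ^ 2) / 16)) * Real.exp (-‖x‖ ^ 2 / 8) := by
          gcongr; exact h1.trans h2
      _ = 16 ^ N * (N.factorial * Real.exp ((1 + ‖x‖ ^ 2) / 16 + -‖x‖ ^ 2 / 8)) := by
          rw [Real.exp_add]; ring
      _ = 16 ^ N * (N.factorial * Real.exp (1 / 16 + -‖x‖ ^ 2 / 16)) := by
          congr 3; ring
      _ = _ := by rw [Real.exp_add]; ring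

theorem exists_sum_exp_neg_norm_sub_zlift_le (n : ℕ) : ∃ S : ℝ, 0 < S ∧
    ∀ {ι : Type} [Fintype ι] (k : ι → Fin n → ℤ), Function.Injective k →
      ∀ ξ : EuclideanSpace ℝ (Fin n),
        ∑ j, Real.exp (-‖ξ - zlift (k j)‖ ^ 2 / 8) ≤ S := by
  set v : ℝ := volume.real (Metric.ball (0 : EuclideanSpace ℝ (Fin n)) (1 / 2)) with hv
  have hv0 : 0 < v := ENNReal.toReal_pos (Metric.measure_ball_pos _ _ (by norm_num)).ne'
    measure_ball_lt_top.ne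
  have hexpi := integrable_exp_neg_norm_sq_div (n := n) (a := 16) (by norm_num)
  set M : ℝ := ∫ x : EuclideanSpace ℝ (Fin n), Real.exp (-‖x‖ ^ 2 / 16) with hM
  have hM0 : 0 ≤ M := integral_nonneg fun x => (Real.exp_pos _).le
  refine ⟨v⁻¹ * (Real.exp (1 / 32) * M) + 1, by positivity, ?_⟩
  intro ι _ k hk ξ
  have hexpi' : Integrable fun u : EuclideanSpace ℝ (Fin n) =>
      Real.exp (1 / 32) * Real.exp (-‖ξ - u‖ ^ 2 / 16) :=
    (hexpi.comp_sub_left ξ).const_mul _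
  have hball : ∀ j, v * Real.exp (-‖ξ - zlift (k j)‖ ^ 2 / 8) ≤
      ∫ u in Metric.ball (zlift (k j)) (1 / 2),
        Real.exp (1 / 32) * Real.exp (-‖ξ - u‖ ^ 2 / 16) := by
    intro j
    have h1 : v * Real.exp (-‖ξ - zlift (k j)‖ ^ 2 / 8) =
        ∫ u in Metric.ball (zlift (k j)) (1 / 2), Real.exp (-‖ξ - zlift (k j)‖ ^ 2 / 8) := by
      rw [setIntegral_const, smul_eq_mul, hv, measureReal_def, measureReal_def,
        Measure.addHaar_ball_center volume (zlift (k j))]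
    rw [h1]
    refine setIntegral_mono_on (integrableOn_const measure_ball_lt_top.ne) hexpi'.integrableOn
      measurableSet_ball fun u hu => ?_
    rw [← Real.exp_add, Real.exp_le_exp]
    have h2 : ‖zlift (k j) - u‖ ≤ 1 / 2 := by
      rw [← dist_eq_norm, dist_comm]
      exact (Metric.mem_ball.1 hu).le
    have h3 : ‖ξ - u‖ ≤ ‖ξ - zlift (k j)‖ + ‖zlift (k j) - u‖ := norm_sub_le_norm_sub_add_norm_sub ..
    have h4 : ‖ξ - u‖ ^ 2 ≤ (‖ξ - zlift (k j)‖ + 1 / 2) ^ 2 := by gcongr; linarith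
    nlinarith [sq_nonneg (‖ξ - zlift (k j)‖ - 1 / 2)]
  have hdisj : Pairwise (Function.onFun Disjoint
      fun j => Metric.ball (zlift (k j)) (1 / 2 : ℝ)) := by
    intro i j hij
    apply Metric.ball_disjoint_ball
    rw [dist_eq_norm]
    have := one_le_norm_zlift_sub (hk.ne hij)
    linarith
  have hsum : v * ∑ j, Real.exp (-‖ξ - zlift (k j)‖ ^ 2 / 8) ≤ Real.exp (1 / 32) * M := by
    calc _ ≤ ∑ j, ∫ u in Metric.ball (zlift (k j)) (1 / 2),
          Real.exp (1 / 32) * Real.exp (-‖ξ - u‖ ^ 2 / 16) := by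
          rw [Finset.mul_sum]
          exact Finset.sum_le_sum fun j _ => hball j
      _ = ∫ u in ⋃ j, Metric.ball (zlift (k j)) (1 / 2),
          Real.exp (1 / 32) * Real.exp (-‖ξ - u‖ ^ 2 / 16) :=
          (integral_iUnion_fintype (fun j => measurableSet_ball) hdisj
            fun j => hexpi'.integrableOn).symm
      _ ≤ ∫ u, Real.exp (1 / 32) * Real.exp (-‖ξ - u‖ ^ 2 / 16) :=
          setIntegral_le_integral hexpi' (Filter.Eventually.of_forall fun u => by positivity)
      _ = _ := by
          rw [integral_const_mul,
            integral_sub_left_eq_self (fun x : EuclideanSpace ℝ (Fin n) =>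
              Real.exp (-‖x‖ ^ 2 / 16)) volume ξ]
  rw [mul_comm, ← le_div_iff₀ hv0] at hsum
  rw [div_eq_inv_mul] at hsum
  linarith

theorem lpN_ofReal {p : ℝ} (hp : 0 ≤ p) (F : EuclideanSpace ℝ (Fin n) → ℝ≥0∞) :
    lpN (ENNReal.ofReal p) F = (∫⁻ x, F x ^ p) ^ p⁻¹ := by
  rw [lpN, if_neg ENNReal.ofReal_ne_top, ENNReal.toReal_ofReal hp]

theorem sum_mul_rpow_le {ι : Type*} [Fintype ι] {q : ℝ} (hq : 1 ≤ q) {w f : ι → ℝ}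
    (hw : ∀ j, 0 ≤ w j) (hf : ∀ j, 0 ≤ f j) :
    (∑ j, w j * f j) ^ q ≤ (∑ j, w j) ^ (q - 1) * ∑ j, w j * f j ^ q := by
  have hq0 : 0 < q := by linarith
  have h := Real.inner_le_weight_mul_Lp_of_nonneg Finset.univ hq w f hw hf
  have hW : 0 ≤ ∑ j, w j := Finset.sum_nonneg fun j _ => hw j
  have hF : 0 ≤ ∑ j, w j * f j ^ q :=
    Finset.sum_nonneg fun j _ => mul_nonneg (hw j) (Real.rpow_nonneg (hf j) _)
  calc _ ≤ ((∑ j, w j) ^ (1 - q⁻¹) * (∑ j, w j * f j ^ q) ^ q⁻¹) ^ q :=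
        Real.rpow_le_rpow (Finset.sum_nonneg fun j _ => mul_nonneg (hw j) (hf j)) h hq0.le
    _ = _ := by
      rw [Real.mul_rpow (by positivity) (by positivity), ← Real.rpow_mul hW, ← Real.rpow_mul hF,
        inv_mul_cancel₀ hq0.ne', Real.rpow_one, sub_mul, one_mul, inv_mul_cancel₀ hq0.ne']

theorem WNorm_sum_modulatedGaussian_le (n : ℕ) (s : ℝ) {p q : ℝ} (hp : 1 ≤ p) (hq : 1 ≤ q) :
    ∃ C : ℝ, 0 < C ∧ ∀ {ι : Type} [Fintype ι] (k : ι → Fin n → ℤ), Function.Injective k →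
      ∀ d : ι → ℂ, WNorm s (ENNReal.ofReal p) (ENNReal.ofReal q)
          (∑ j, d j • modulatedGaussian (zlift (k j)) : SchwartzMap _ ℂ) ≤
        ENNReal.ofReal (C * (∑ j, jp (s * q) (zlift (k j)) * ‖d j‖ ^ q) ^ (1 / q)) := by
  have hp0 : 0 < p := by linarith
  have hq0 : 0 < q := by linarith
  obtain ⟨S, hS, hSle⟩ := exists_sum_exp_neg_norm_sub_zlift_le n
  set A : ℝ := ‖((π : ℂ) / 2) ^ (n / 2 : ℂ)‖ with hA
  have hA0 : 0 ≤ A := norm_nonneg _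
  set m : EuclideanSpace ℝ (Fin n) → ℝ := fun x => jp |s * q| x * Real.exp (-‖x‖ ^ 2 / 8) with hm
  have hm0 : ∀ x, 0 ≤ m x := fun x => (mul_pos (jp_pos _ _) (Real.exp_pos _)).le
  have hmi : Integrable m := integrable_jp_mul_exp _
  set M : ℝ := ∫ x, m x with hM
  have hM0 : 0 ≤ M := integral_nonneg hm0
  set P : ℝ := A ^ q * S ^ (q - 1) * 2 ^ (|s * q| / 2) with hP
  have hP0 : 0 ≤ P := by positivity
  have hgi : Integrable fun x : EuclideanSpace ℝ (Fin n) => Real.exp (-‖x‖ ^ 2 / (2 / p)) :=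
    integrable_exp_neg_norm_sq_div (by positivity)
  set G : ℝ := ∫ x : EuclideanSpace ℝ (Fin n), Real.exp (-‖x‖ ^ 2 / (2 / p)) with hG
  have hG0 : 0 ≤ G := integral_nonneg fun x => (Real.exp_pos _).le
  refine ⟨G ^ (1 / p) * (P * M) ^ (1 / q) + 1, by positivity, ?_⟩
  intro ι _ k hk d
  set R : ℝ := ∑ j, jp (s * q) (zlift (k j)) * ‖d j‖ ^ q with hR
  have hR0 : 0 ≤ R := Finset.sum_nonneg fun j _ => mul_nonneg (jp_pos _ _).le (by positivity)
  have hpoint : ∀ x ξ : EuclideanSpace ℝ (Fin n),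
      (jp s ξ * ‖STFT gauss (∑ j, d j • modulatedGaussian (zlift (k j)) : SchwartzMap _ ℂ) x ξ‖) ^ q
        ≤ P * Real.exp (-‖x‖ ^ 2 / 2) ^ q *
          ∑ j, jp (s * q) (zlift (k j)) * ‖d j‖ ^ q * m (ξ - zlift (k j)) := by
    intro x ξ
    have h1 : ‖STFT gauss (∑ j, d j • modulatedGaussian (zlift (k j)) : SchwartzMap _ ℂ) x ξ‖ ≤
        A * Real.exp (-‖x‖ ^ 2 / 2) * ∑ j, Real.exp (-‖ξ - zlift (k j)‖ ^ 2 / 8) * ‖d j‖ := by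
      rw [STFT_sum_modulatedGaussian, Finset.mul_sum]
      refine norm_sum_le_of_le _ fun j _ => ?_
      rw [norm_mul, norm_STFT_modulatedGaussian]
      exact le_of_eq (by ring)
    have h2 := sum_mul_rpow_le hq (w := fun j => Real.exp (-‖ξ - zlift (k j)‖ ^ 2 / 8))
      (f := fun j => ‖d j‖) (fun j => (Real.exp_pos _).le) fun j => norm_nonneg _
    rw [Real.mul_rpow (jp_pos _ _).le (norm_nonneg _), jp_rpow]
    calc _ ≤ jp (s * q) ξ * (A * Real.exp (-‖x‖ ^ 2 / 2) *
            ∑ j, Real.exp (-‖ξ - zlift (k j)‖ ^ 2 / 8) * ‖d j‖) ^ q := by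
          refine mul_le_mul_of_nonneg_left ?_ (jp_pos _ _).le
          exact Real.rpow_le_rpow (norm_nonneg _) h1 hq0.le
      _ = jp (s * q) ξ * (A ^ q * Real.exp (-‖x‖ ^ 2 / 2) ^ q *
            (∑ j, Real.exp (-‖ξ - zlift (k j)‖ ^ 2 / 8) * ‖d j‖) ^ q) := by
          rw [Real.mul_rpow (by positivity) (by positivity), Real.mul_rpow hA0 (by positivity)]
      _ ≤ jp (s * q) ξ * (A ^ q * Real.exp (-‖x‖ ^ 2 / 2) ^ q *
            (S ^ (q - 1) * ∑ j, Real.exp (-‖ξ - zlift (k j)‖ ^ 2 / 8) * ‖d j‖ ^ q)) := by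
          refine mul_le_mul_of_nonneg_left ?_ (jp_pos _ _).le
          refine mul_le_mul_of_nonneg_left (h2.trans ?_) (by positivity)
          refine mul_le_mul_of_nonneg_right ?_ (by positivity)
          exact Real.rpow_le_rpow (by positivity) (hSle k hk ξ) (by linarith)
      _ = A ^ q * S ^ (q - 1) * Real.exp (-‖x‖ ^ 2 / 2) ^ q *
            ∑ j, jp (s * q) ξ * (Real.exp (-‖ξ - zlift (k j)‖ ^ 2 / 8) * ‖d j‖ ^ q) := by
          rw [← Finset.mul_sum]; ring
      _ ≤ A ^ q * S ^ (q - 1) * Real.exp (-‖x‖ ^ 2 / 2) ^ q *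
            ∑ j, (2 ^ (|s * q| / 2) * jp (s * q) (zlift (k j)) * jp |s * q| (ξ - zlift (k j))) *
              (Real.exp (-‖ξ - zlift (k j)‖ ^ 2 / 8) * ‖d j‖ ^ q) := by
          gcongr with j _
          exact jp_le_mul_jp _ _ _
      _ = _ := by
          rw [hP, Finset.mul_sum, Finset.mul_sum]
          refine Finset.sum_congr rfl fun j _ => ?_
          simp only [hm]
          ring
  have hinner : ∀ x : EuclideanSpace ℝ (Fin n),
      ∫⁻ ξ, (ENNReal.ofReal (jp s ξ) * (‖STFT gauss
        (∑ j, d j • modulatedGaussian (zlift (k j)) : SchwartzMap _ ℂ) x ξ‖₊ : ℝ≥0∞)) ^ q ≤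
      ENNReal.ofReal (P * M * R * Real.exp (-‖x‖ ^ 2 / 2) ^ q) := by
    intro x
    have hi : ∀ j ∈ Finset.univ, Integrable fun ξ : EuclideanSpace ℝ (Fin n) =>
        jp (s * q) (zlift (k j)) * ‖d j‖ ^ q * m (ξ - zlift (k j)) :=
      fun j _ => (hmi.comp_sub_right _).const_mul _
    have hval : ∫ ξ, P * Real.exp (-‖x‖ ^ 2 / 2) ^ q *
          ∑ j, jp (s * q) (zlift (k j)) * ‖d j‖ ^ q * m (ξ - zlift (k j)) =
        P * M * R * Real.exp (-‖x‖ ^ 2 / 2) ^ q := by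
      rw [integral_const_mul, integral_finsetSum _ hi]
      simp_rw [integral_const_mul, integral_sub_right_eq_self m, ← Finset.sum_mul]
      rw [← hM, ← hR]
      ring
    rw [← hval, ofReal_integral_eq_lintegral_ofReal ((integrable_finsetSum _ hi).const_mul _)
      (Filter.Eventually.of_forall fun ξ => mul_nonneg (by positivity)
        (Finset.sum_nonneg fun j _ => mul_nonneg (mul_nonneg (jp_pos _ _).le (by positivity))
          (hm0 _)))]
    refine lintegral_mono fun ξ => ?_
    rw [← enorm_eq_nnnorm, ← ofReal_norm, ← ENNReal.ofReal_mul (jp_pos _ _).le,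
      ENNReal.ofReal_rpow_of_nonneg (mul_nonneg (jp_pos _ _).le (norm_nonneg _)) hq0.le]
    exact ENNReal.ofReal_le_ofReal (hpoint x ξ)
  rw [WNorm, lpN_ofReal hp0.le]
  simp_rw [lpN_ofReal hq0.le]
  have hPMR : 0 ≤ P * M * R := by positivity
  have houter : ∫⁻ x : EuclideanSpace ℝ (Fin n), ((∫⁻ ξ, (ENNReal.ofReal (jp s ξ) * (‖STFT gauss
        (∑ j, d j • modulatedGaussian (zlift (k j)) : SchwartzMap _ ℂ) x ξ‖₊ : ℝ≥0∞)) ^ q) ^ q⁻¹) ^ p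
      ≤ ENNReal.ofReal (((P * M * R) ^ q⁻¹) ^ p * G) := by
    rw [hG, ← integral_const_mul, ofReal_integral_eq_lintegral_ofReal (hgi.const_mul _)
      (Filter.Eventually.of_forall fun x => by positivity)]
    refine lintegral_mono fun x => ?_
    calc _ ≤ (ENNReal.ofReal (P * M * R * Real.exp (-‖x‖ ^ 2 / 2) ^ q) ^ q⁻¹) ^ p := by
          gcongr
          exact hinner x
      _ = _ := by
          rw [ENNReal.ofReal_rpow_of_nonneg (by positivity) (by positivity),
            ENNReal.ofReal_rpow_of_nonneg (by positivity) (by positivity),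
            Real.mul_rpow hPMR (by positivity), ← Real.rpow_mul (Real.exp_pos _).le,
            mul_inv_cancel₀ hq0.ne', Real.rpow_one, Real.mul_rpow (by positivity) (by positivity),
            ← Real.exp_mul]
          congr 3
          field_simp
  calc _ ≤ ENNReal.ofReal (((P * M * R) ^ q⁻¹) ^ p * G) ^ p⁻¹ := by gcongr
    _ = ENNReal.ofReal ((G ^ (1 / p) * (P * M) ^ (1 / q)) * R ^ (1 / q)) := by
      rw [ENNReal.ofReal_rpow_of_nonneg (by positivity) (by positivity),
        Real.mul_rpow (by positivity) hG0, ← Real.rpow_mul (by positivity),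
        mul_inv_cancel₀ hp0.ne', Real.rpow_one, Real.mul_rpow (by positivity) hR0, one_div, one_div]
      congr 1
      ring
    _ ≤ _ := by
      apply ENNReal.ofReal_le_ofReal
      gcongr
      linarith

end UpperBound

section LowerBound

/-- If every summand is dominated by two members of a family exchanged by a bijection of its
index set, then the family is on average large on many disjoint sets at once. -/
theorem sum_measure_mul_rpow_le_of_family {X Y ι Θ : Type*} [MeasurableSpace X]
    [MeasurableSpace Y] [Fintype ι] [Fintype Θ] [Nonempty Θ] {μ : Measure X} {ν : Measure Y}
    [SFinite ν] {p q : ℝ} (hp : 1 ≤ p) (hq : 1 ≤ q) {V : Θ → X → Y → ℂ}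
    (hVm : ∀ σ, Measurable fun z : X × Y => V σ z.1 z.2) (e : ι → Θ ≃ Θ)
    {B : ι → Set X} (hB : ∀ j, MeasurableSet (B j)) (hBd : Pairwise (Function.onFun Disjoint B))
    {D : ι → Set Y} (hD : ∀ j, MeasurableSet (D j)) {w : ι → ℝ≥0∞}
    (hw : ∀ σ j, ∀ x ∈ B j, ∀ ξ ∈ D j, w j ≤ ‖V σ x ξ‖ₑ ∨ w j ≤ ‖V (e j σ) x ξ‖ₑ) {K : ℝ≥0∞}
    (hK : ∀ σ, ∫⁻ x, (∫⁻ ξ, ‖V σ x ξ‖ₑ ^ q ∂ν) ^ (p / q) ∂μ ≤ K) :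
    ∑ j, μ (B j) * (ν (D j) * w j ^ q / 2) ^ (p / q) ≤ 2 * K := by
  have hq0 : 0 < q := by linarith
  have hr : 0 ≤ p / q := by positivity
  set I : Θ → X → ℝ≥0∞ := fun σ x => ∫⁻ ξ, ‖V σ x ξ‖ₑ ^ q ∂ν with hI
  have hIm : ∀ σ, Measurable (I σ) := fun σ =>
    ((hVm σ).enorm.pow_const q).lintegral_prod_right'
  have hVx : ∀ σ x, Measurable fun ξ => ‖V σ x ξ‖ₑ ^ q := fun σ x =>
    ((hVm σ).enorm.pow_const q).comp measurable_prodMk_left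
  have hpoint : ∀ σ j, ∀ x ∈ B j, ∀ ξ ∈ D j,
      w j ^ q ≤ ‖V σ x ξ‖ₑ ^ q + ‖V (e j σ) x ξ‖ₑ ^ q := by
    intro σ j x hx ξ hξ
    rcases hw σ j x hx ξ hξ with h | h
    · exact (ENNReal.rpow_le_rpow h hq0.le).trans le_self_add
    · exact (ENNReal.rpow_le_rpow h hq0.le).trans le_add_self
  have hinner : ∀ σ j, ∀ x ∈ B j,
      ν (D j) * w j ^ q ≤ I σ x + I (e j σ) x := by
    intro σ j x hx
    calc ν (D j) * w j ^ q = ∫⁻ ξ in D j, w j ^ q ∂ν := by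
          rw [setLIntegral_const, mul_comm]
      _ ≤ ∫⁻ ξ in D j, (‖V σ x ξ‖ₑ ^ q + ‖V (e j σ) x ξ‖ₑ ^ q) ∂ν :=
          setLIntegral_mono' (hD j) fun ξ hξ => hpoint σ j x hx ξ hξ
      _ ≤ ∫⁻ ξ, (‖V σ x ξ‖ₑ ^ q + ‖V (e j σ) x ξ‖ₑ ^ q) ∂ν := setLIntegral_le_lintegral _ _
      _ = _ := lintegral_add_left (hVx σ x) _
  have hhalf : ∀ σ j, ∀ x ∈ B j,
      (ν (D j) * w j ^ q / 2) ^ (p / q) ≤ I σ x ^ (p / q) + I (e j σ) x ^ (p / q) := by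
    intro σ j x hx
    rcases le_total (I σ x) (I (e j σ) x) with h | h
    · refine le_trans (ENNReal.rpow_le_rpow (ENNReal.div_le_of_le_mul ?_) hr) le_add_self
      rw [mul_two]
      exact (hinner σ j x hx).trans (by gcongr)
    · refine le_trans (ENNReal.rpow_le_rpow (ENNReal.div_le_of_le_mul ?_) hr) le_self_add
      rw [mul_two]
      exact (hinner σ j x hx).trans (by gcongr)
  set N : ℝ≥0∞ := (Fintype.card Θ : ℝ≥0∞) with hN
  have hmean : ∀ j, ∀ x ∈ B j,
      N * (ν (D j) * w j ^ q / 2) ^ (p / q) ≤ 2 * ∑ σ, I σ x ^ (p / q) := by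
    intro j x hx
    calc _ = ∑ σ : Θ, (ν (D j) * w j ^ q / 2) ^ (p / q) := by simp [hN]
      _ ≤ ∑ σ, (I σ x ^ (p / q) + I (e j σ) x ^ (p / q)) :=
          Finset.sum_le_sum fun σ _ => hhalf σ j x hx
      _ = _ := by
          rw [Finset.sum_add_distrib, two_mul]
          congr 1
          exact (e j).sum_comp fun σ => I σ x ^ (p / q)
  have hfin : N * ∑ j, μ (B j) * (ν (D j) * w j ^ q / 2) ^ (p / q) ≤ N * (2 * K) := by
    calc _ = ∑ j, ∫⁻ x in B j, N * (ν (D j) * w j ^ q / 2) ^ (p / q) ∂μ := by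
          rw [Finset.mul_sum]
          refine Finset.sum_congr rfl fun j _ => ?_
          rw [setLIntegral_const]
          ring
      _ ≤ ∑ j, ∫⁻ x in B j, 2 * ∑ σ, I σ x ^ (p / q) ∂μ :=
          Finset.sum_le_sum fun j _ => setLIntegral_mono' (hB j) fun x hx => hmean j x hx
      _ = ∫⁻ x in ⋃ j, B j, 2 * ∑ σ, I σ x ^ (p / q) ∂μ := by
          rw [lintegral_iUnion hB hBd, tsum_fintype]
      _ ≤ ∫⁻ x, 2 * ∑ σ, I σ x ^ (p / q) ∂μ := setLIntegral_le_lintegral _ _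
      _ = 2 * ∑ σ, ∫⁻ x, I σ x ^ (p / q) ∂μ := by
          rw [lintegral_const_mul _ (Finset.measurable_fun_sum _ fun σ _ => (hIm σ).pow_const _),
            lintegral_finsetSum _ fun σ _ => (hIm σ).pow_const _]
      _ ≤ 2 * ∑ σ : Θ, K := by
          gcongr with σ
          exact hK σ
      _ = _ := by simp [hN]; ring
  rwa [ENNReal.mul_le_mul_iff_right (by simp [hN]) (by simp [hN])] at hfin

open Classical in
/-- Changing the sign of one summand permutes the sums with signs, so these are on average at least
as large as each of their summands. -/
theorem sum_measure_mul_rpow_le_of_signs {X Y ι : Type*} [MeasurableSpace X] [MeasurableSpace Y]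
    [Fintype ι] {μ : Measure X} {ν : Measure Y} [SFinite ν] {p q : ℝ} (hp : 1 ≤ p) (hq : 1 ≤ q)
    {a : ι → X → Y → ℂ} (ha : ∀ j, Measurable fun z : X × Y => a j z.1 z.2)
    {B : ι → Set X} (hB : ∀ j, MeasurableSet (B j)) (hBd : Pairwise (Function.onFun Disjoint B))
    {D : ι → Set Y} (hD : ∀ j, MeasurableSet (D j)) {w : ι → ℝ≥0∞}
    (hw : ∀ j, ∀ x ∈ B j, ∀ ξ ∈ D j, w j ≤ ‖a j x ξ‖ₑ) {K : ℝ≥0∞}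
    (hK : ∀ σ : ι → ℤˣ,
      ∫⁻ x, (∫⁻ ξ, ‖∑ j, ((σ j : ℤ) : ℂ) * a j x ξ‖ₑ ^ q ∂ν) ^ (p / q) ∂μ ≤ K) :
    ∑ j, μ (B j) * (ν (D j) * w j ^ q / 2) ^ (p / q) ≤ 2 * K := by
  refine sum_measure_mul_rpow_le_of_family hp hq
    (V := fun (σ : ι → ℤˣ) x ξ => ∑ j, ((σ j : ℤ) : ℂ) * a j x ξ)
    (fun σ => Finset.measurable_fun_sum _ fun j _ => (ha j).const_mul _)
    (fun j => Equiv.mulRight (Pi.mulSingle j (-1))) hB hBd hD ?_ hK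
  intro σ j x hx ξ hξ
  have hdiff : ∑ i, ((σ i : ℤ) : ℂ) * a i x ξ -
      ∑ i, ((((Equiv.mulRight (Pi.mulSingle j (-1))) σ) i : ℤ) : ℂ) * a i x ξ =
        2 * (((σ j : ℤ) : ℂ) * a j x ξ) := by
    rw [← Finset.sum_sub_distrib, Finset.sum_eq_single j]
    · simp
      ring
    · intro i _ hij
      simp [hij]
    · simp
  have hnorm := norm_sub_le (∑ i, ((σ i : ℤ) : ℂ) * a i x ξ)
    (∑ i, ((((Equiv.mulRight (Pi.mulSingle j (-1))) σ) i : ℤ) : ℂ) * a i x ξ)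
  have hunit : ‖((σ j : ℤ) : ℂ)‖ = 1 := by
    rcases Int.units_eq_one_or (σ j) with h | h <;> simp [h]
  rw [hdiff, norm_mul, norm_mul, hunit, one_mul, Complex.norm_ofNat] at hnorm
  rw [or_iff_not_imp_left, not_le]
  intro h
  refine (hw j x hx ξ hξ).trans ?_
  rw [enorm_le_iff_norm_le]
  have h' := h.trans_le (hw j x hx ξ hξ)
  rw [← not_le, enorm_le_iff_norm_le, not_le] at h'
  linarith

variable {n : ℕ}

theorem WNorm_zero_rpow {p q : ℝ} (hp : 1 ≤ p) (hq : 1 ≤ q) (f : EuclideanSpace ℝ (Fin n) → ℂ) :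
    WNorm 0 (ENNReal.ofReal p) (ENNReal.ofReal q) f ^ p =
      ∫⁻ x, (∫⁻ ξ, ‖STFT gauss f x ξ‖ₑ ^ q) ^ (p / q) := by
  have hp0 : 0 < p := by linarith
  rw [WNorm, lpN_ofReal hp0.le, ← ENNReal.rpow_mul, inv_mul_cancel₀ hp0.ne', ENNReal.rpow_one]
  refine lintegral_congr fun x => ?_
  rw [lpN_ofReal (by linarith), ← ENNReal.rpow_mul, inv_mul_eq_div]
  simp [jp, enorm_eq_nnnorm]

theorem exists_sequence_ineq {ε : ℝ} (hε : ε ^ 2 = 1) {s p q : ℝ} (hp : 1 ≤ p) (hq : 1 ≤ q) {C : ℝ}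
    (hC : 0 < C) (hbdd : ∀ f : SchwartzMap (EuclideanSpace ℝ (Fin n)) ℂ,
      WNorm 0 (ENNReal.ofReal p) (ENNReal.ofReal q) (schrod ε ⇑f)
        ≤ ENNReal.ofReal C * WNorm s (ENNReal.ofReal p) (ENNReal.ofReal q) ⇑f) :
    ∃ C' : ℝ, 0 < C' ∧ ∀ {ι : Type} [Fintype ι] (k : ι → Fin n → ℤ), Function.Injective k →
      ∀ c : ι → ℂ, (∑ j, ‖c j‖ ^ p) ^ (1 / p)
        ≤ C' * (∑ j, jp (s * q) (zlift (k j)) * ‖c j‖ ^ q) ^ (1 / q) := by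
  have hp0 : 0 < p := by linarith
  have hq0 : 0 < q := by linarith
  obtain ⟨C₁, hC₁, hup⟩ := WNorm_sum_modulatedGaussian_le n s hp hq
  obtain ⟨δ, hδ, hlow⟩ := exists_le_norm_STFT_evolvedGaussian (n := n) hε
  set v : ℝ := volume.real (Metric.ball (0 : EuclideanSpace ℝ (Fin n)) 1) with hv
  have hv0 : 0 < v := ENNReal.toReal_pos (Metric.measure_ball_pos _ _ one_pos).ne'
    measure_ball_lt_top.ne
  have hvol : ∀ y : EuclideanSpace ℝ (Fin n), volume (Metric.ball y 1) = ENNReal.ofReal v := by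
    intro y
    rw [Measure.addHaar_ball_center, hv, ofReal_measureReal measure_ball_lt_top.ne]
  set A : ℝ := v * (v / 2) ^ (p / q) * δ ^ p with hA
  have hA0 : 0 < A := by positivity
  refine ⟨(2 / A) ^ (1 / p) * (C * C₁), by positivity, ?_⟩
  intro ι _ k hk c
  set R : ℝ := ∑ j, jp (s * q) (zlift (k j)) * ‖c j‖ ^ q with hR
  have hR0 : 0 ≤ R := Finset.sum_nonneg fun j _ => mul_nonneg (jp_pos _ _).le (by positivity)
  have hε1 : |ε| = 1 := by
    rw [← sq_eq_sq₀ (abs_nonneg _) zero_le_one, sq_abs, hε, one_pow]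
  have key := sum_measure_mul_rpow_le_of_signs (μ := volume) (ν := volume) hp hq
    (a := fun j x ξ => c j * STFT gauss (evolvedGaussian ε (zlift (k j))) x ξ)
    (fun j => (continuous_const.mul (continuous_STFT_evolvedGaussian ε _)).measurable)
    (B := fun j => Metric.ball ((2 * ε) • zlift (k j)) 1) (fun j => measurableSet_ball) ?_
    (D := fun j => Metric.ball (zlift (k j)) 1) (fun j => measurableSet_ball)
    (w := fun j => ENNReal.ofReal (δ * ‖c j‖)) ?_
    (K := ENNReal.ofReal ((C * (C₁ * R ^ (1 / q))) ^ p)) ?_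
  · have hterm : ∀ j, volume (Metric.ball ((2 * ε) • zlift (k j)) 1) *
        (volume (Metric.ball (zlift (k j)) 1) * ENNReal.ofReal (δ * ‖c j‖) ^ q / 2) ^ (p / q) =
          ENNReal.ofReal (A * ‖c j‖ ^ p) := by
      intro j
      have h2 : (2 : ℝ≥0∞) = ENNReal.ofReal 2 := by simp
      rw [hvol, hvol, ENNReal.ofReal_rpow_of_nonneg (by positivity) hq0.le, h2,
        ← ENNReal.ofReal_mul hv0.le, ← ENNReal.ofReal_div_of_pos two_pos,
        ENNReal.ofReal_rpow_of_nonneg (by positivity) (by positivity),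
        ← ENNReal.ofReal_mul hv0.le]
      congr 1
      rw [mul_div_right_comm, Real.mul_rpow (by positivity) (by positivity),
        ← Real.rpow_mul (by positivity), mul_div_cancel₀ _ hq0.ne',
        Real.mul_rpow hδ.le (norm_nonneg _), hA]
      ring
    rw [Finset.sum_congr rfl fun j _ => hterm j, ← ENNReal.ofReal_sum_of_nonneg
      (fun j _ => by positivity), ← Finset.mul_sum] at key
    have h2 : (2 : ℝ≥0∞) = ENNReal.ofReal 2 := by simp
    rw [h2, ← ENNReal.ofReal_mul two_pos.le, ENNReal.ofReal_le_ofReal_iff (by positivity)] at key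
    have h3 : ∑ j, ‖c j‖ ^ p ≤ 2 / A * (C * (C₁ * R ^ (1 / q))) ^ p := by
      rw [div_mul_eq_mul_div, le_div_iff₀ hA0]
      linarith
    calc _ ≤ (2 / A * (C * (C₁ * R ^ (1 / q))) ^ p) ^ (1 / p) :=
          Real.rpow_le_rpow (Finset.sum_nonneg fun j _ => by positivity) h3 (by positivity)
      _ = _ := by
          rw [Real.mul_rpow (by positivity) (by positivity), ← Real.rpow_mul (by positivity),
            mul_one_div_cancel hp0.ne', Real.rpow_one]
          ring
  · intro i j hij
    apply Metric.ball_disjoint_ball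
    rw [dist_eq_norm, ← smul_sub, norm_smul, Real.norm_eq_abs, abs_mul, hε1, abs_two]
    have := one_le_norm_zlift_sub (hk.ne hij)
    linarith
  · intro j x hx ξ hξ
    rw [← ofReal_norm, norm_mul]
    refine ENNReal.ofReal_le_ofReal ?_
    rw [mul_comm]
    refine mul_le_mul_of_nonneg_left (hlow _ _ _ ?_ ?_) (norm_nonneg _)
    · exact (mem_ball_iff_norm.1 hx).le
    · exact (mem_ball_iff_norm.1 hξ).le
  · intro σ
    have hnorm : ∀ j, ‖((σ j : ℤ) : ℂ) * c j‖ = ‖c j‖ := by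
      intro j
      rcases Int.units_eq_one_or (σ j) with h | h <;> simp [h]
    have h1 := (hbdd (∑ j, (((σ j : ℤ) : ℂ) * c j) • modulatedGaussian (zlift (k j)))).trans
      (mul_le_mul_right (hup k hk fun j => ((σ j : ℤ) : ℂ) * c j) _)
    rw [schrod_sum_modulatedGaussian, ← ENNReal.ofReal_mul hC.le] at h1
    simp only [hnorm] at h1
    have h2 := ENNReal.rpow_le_rpow h1 hp0.le
    rw [WNorm_zero_rpow hp hq, ENNReal.ofReal_rpow_of_nonneg (by positivity) hp0.le] at h2
    simp only [STFT_sum_evolvedGaussian] at h2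
    simpa only [mul_assoc] using h2

end LowerBound

/-- Key lemma: for `n ≥ 1`, `s ∈ ℝ`, `1 ≤ p, q < ∞`, if `e^{iΔ}` or `e^{-iΔ}` is bounded from
`W^s_{p,q}` to `W_{p,q}` (on Schwartz functions), then
`(Σ_k |c_k|^p)^{1/p} ≲ (Σ_k ⟨k⟩^{sq} |c_k|^q)^{1/q}` for all finitely supported
sequences `{c_k}_{k ∈ ℤⁿ}` of complex numbers. -/
theorem sequence_ineq_of_schrod_bounded (n : ℕ) (hn : 1 ≤ n) (s : ℝ) (p q : ℝ)
    (hp : 1 ≤ p) (hq : 1 ≤ q)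
    (hbdd : (∃ C : ℝ, 0 < C ∧ ∀ f : SchwartzMap (EuclideanSpace ℝ (Fin n)) ℂ,
        WNorm 0 (ENNReal.ofReal p) (ENNReal.ofReal q) (schrod 1 ⇑f)
          ≤ ENNReal.ofReal C * WNorm s (ENNReal.ofReal p) (ENNReal.ofReal q) ⇑f) ∨
      (∃ C : ℝ, 0 < C ∧ ∀ f : SchwartzMap (EuclideanSpace ℝ (Fin n)) ℂ,
        WNorm 0 (ENNReal.ofReal p) (ENNReal.ofReal q) (schrod (-1) ⇑f)
          ≤ ENNReal.ofReal C * WNorm s (ENNReal.ofReal p) (ENNReal.ofReal q) ⇑f)) :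
    ∃ C' : ℝ, 0 < C' ∧ ∀ c : (Fin n → ℤ) →₀ ℂ,
      (∑ k ∈ c.support, ‖c k‖ ^ p) ^ (1 / p)
        ≤ C' * (∑ k ∈ c.support, jp (s * q) (zlift k) * ‖c k‖ ^ q) ^ (1 / q) := by
  have main : ∀ ε : ℝ, ε ^ 2 = 1 →
      (∃ C : ℝ, 0 < C ∧ ∀ f : SchwartzMap (EuclideanSpace ℝ (Fin n)) ℂ,
        WNorm 0 (ENNReal.ofReal p) (ENNReal.ofReal q) (schrod ε ⇑f)
          ≤ ENNReal.ofReal C * WNorm s (ENNReal.ofReal p) (ENNReal.ofReal q) ⇑f) →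
      ∃ C' : ℝ, 0 < C' ∧ ∀ c : (Fin n → ℤ) →₀ ℂ,
        (∑ k ∈ c.support, ‖c k‖ ^ p) ^ (1 / p)
          ≤ C' * (∑ k ∈ c.support, jp (s * q) (zlift k) * ‖c k‖ ^ q) ^ (1 / q) := by
    rintro ε hε ⟨C, hC, h⟩
    obtain ⟨C', hC', hseq⟩ := exists_sequence_ineq hε hp hq hC h
    refine ⟨C', hC', fun c => ?_⟩
    rw [← Finset.sum_coe_sort c.support, ← Finset.sum_coe_sort c.support]
    exact hseq (fun k : c.support => (k : Fin n → ℤ)) Subtype.val_injective fun k => c k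
  exact hbdd.elim (main 1 (by norm_num)) (main (-1) (by norm_num))

end
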